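/- arXiv:2405.05666 — 2 statements merged into one kernel-verified Lean document; each statement's English description precedes it below -/
import Mathlib

section
/- Let (V, {f_{il}}) be a weak lower perfect space over k with a lower perfect basis B. For any (i,l) ∈ I^∞ and n ∈ ℤ_{≥0}, the subspace f_{il}^n V equals the k-span of the subset 𝐟_{il}^n(B) \ {0} of B; in particular f_{il}^n V = ⊕_{b ∈ 𝐟_{il}^n(B) \ {0}} k·b. -/
open Function

/-- A weak lower perfect space: a `P`-graded `k`-vector space `V = ⊕_{μ ∈ P} V_μ`
with endomorphisms `f il` for `(i,l) ∈ I^∞ = I × ℤ_{>0}`. -/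
structure WeakLowerPerfectSpace (k I P V : Type*) [Field k] [AddCommGroup P]
    [AddCommGroup V] [Module k V] where
  /-- the simple roots `α_i` -/
  alpha : I → P
  alpha_indep : LinearIndependent ℤ alpha
  /-- `P` is a free abelian group -/
  free : Module.Free ℤ P
  /-- the weight spaces `V_μ` -/
  weight : P → Submodule k V
  weight_indep : iSupIndep weight
  weight_sup : ⨆ μ : P, weight μ = ⊤
  /-- the endomorphisms `f_{il}` -/
  f : I × ℕ+ → Module.End k V
  finiteDim : ∀ μ : P, Module.Finite k (weight μ)
  support_bounded : ∃ s : Finset P, ∀ μ : P, weight μ ≠ ⊥ →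
    ∃ lam ∈ s, lam - μ ∈ AddSubmonoid.closure (Set.range alpha)
  f_weight : ∀ (i : I) (l : ℕ+) (μ : P),
    (weight μ).map (f (i, l)) ≤ weight (μ - (l : ℕ) • alpha i)

namespace WeakLowerPerfectSpace

variable {k I P V : Type*} [Field k] [AddCommGroup P] [AddCommGroup V] [Module k V]

/-- `d il v` is the unique `n` with `v ∈ f_{il}^n V \ f_{il}^{n+1} V` (for `v ≠ 0`),
realized as the largest `n` with `v ∈ f_{il}^n V`. -/
noncomputable def d (S : WeakLowerPerfectSpace k I P V) (il : I × ℕ+) (v : V) : ℕ :=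
  sSup {n : ℕ | v ∈ LinearMap.range (S.f il ^ n)}

end WeakLowerPerfectSpace

/-- A lower perfect basis `B` of a weak lower perfect space, with structure maps
`F il : B → B ∪ {0}` (extended by `F il 0 = 0`). -/
structure LowerPerfectBasis {k I P V : Type*} [Field k] [AddCommGroup P]
    [AddCommGroup V] [Module k V] (S : WeakLowerPerfectSpace k I P V) (B : Set V) where
  indep : LinearIndependent k (fun b : B => (b : V))
  spans : Submodule.span k B = ⊤
  graded : ∀ b ∈ B, ∃ μ : P, b ∈ S.weight μ
  /-- the structure map `𝐟_{il}` -/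
  F : I × ℕ+ → V → V
  F_zero : ∀ il : I × ℕ+, F il 0 = 0
  F_mem : ∀ il : I × ℕ+, ∀ b ∈ B, F il b ∈ B ∪ {0}
  F_approx : ∀ il : I × ℕ+, ∀ b ∈ B, ∃ c : kˣ,
    S.f il b - (c : k) • F il b ∈ LinearMap.range (S.f il ^ (S.d il b + 2))
  F_inj : ∀ b ∈ B, ∀ b' ∈ B, (∀ il : I × ℕ+, F il b = F il b') → b = b'

namespace WeakLowerPerfectSpace

variable {k I P V : Type*} [Field k] [AddCommGroup P] [AddCommGroup V] [Module k V]

/-- The subspace `Σ_{(i,l) ∈ I^∞} f_{il} V`. -/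
noncomputable def rad (S : WeakLowerPerfectSpace k I P V) : Submodule k V :=
  ⨆ il : I × ℕ+, LinearMap.range (S.f il)

/-- The highest core `B_H = {b ∈ B | d_{il}(b) = 0 for all (i,l) ∈ I^∞}`. -/
def highestCore (S : WeakLowerPerfectSpace k I P V) (B : Set V) : Set V :=
  {b | b ∈ B ∧ ∀ il : I × ℕ+, S.d il b = 0}

end WeakLowerPerfectSpace

namespace WeakLowerPerfectSpace

variable {k I P V : Type*} [Field k] [AddCommGroup P] [AddCommGroup V] [Module k V]

/-- The projections of a weak lower perfect space onto its weight spaces. -/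
theorem exists_weight_proj (S : WeakLowerPerfectSpace k I P V) (μ : P) :
    ∃ p : V →ₗ[k] V, (∀ v ∈ S.weight μ, p v = v) ∧
      ∀ ν, ν ≠ μ → ∀ v ∈ S.weight ν, p v = 0 := by
  classical
  have hint : DirectSum.IsInternal S.weight :=
    DirectSum.isInternal_submodule_of_iSupIndep_of_iSup_eq_top S.weight_indep S.weight_sup
  let := hint.chooseDecomposition
  refine ⟨(S.weight μ).subtype ∘ₗ DirectSum.component k P (fun ν => S.weight ν) μ ∘ₗ
    (DirectSum.decomposeLinearEquiv S.weight).toLinearMap, ?_, ?_⟩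
  · intro v hv
    exact DirectSum.decompose_of_mem_same S.weight hv
  · intro ν hν v hv
    exact DirectSum.decompose_of_mem_ne S.weight hv hν

theorem f_pow_mem_weight (S : WeakLowerPerfectSpace k I P V) (i : I) (l : ℕ+) (N : ℕ) {ν : P}
    {v : V} (hv : v ∈ S.weight ν) :
    (S.f (i, l) ^ N) v ∈ S.weight (ν - (N * (l : ℕ)) • S.alpha i) := by
  induction N with
  | zero => simpa using hv
  | succ N ih =>
    rw [pow_succ', Module.End.mul_apply]
    have h := S.f_weight i l _ (Submodule.mem_map_of_mem ih)
    rwa [sub_sub, ← add_nsmul, ← Nat.succ_mul] at h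

theorem proj_f_pow_mem (S : WeakLowerPerfectSpace k I P V) (i : I) (l : ℕ+) (N : ℕ) (μ : P)
    (p : V →ₗ[k] V) (hp : ∀ v ∈ S.weight μ, p v = v)
    (hp' : ∀ ν, ν ≠ μ → ∀ v ∈ S.weight ν, p v = 0) (v : V) :
    p ((S.f (i, l) ^ N) v) ∈
      (S.weight (μ + (N * (l : ℕ)) • S.alpha i)).map (S.f (i, l) ^ N) := by
  have hv : v ∈ ⨆ ν, S.weight ν := by rw [S.weight_sup]; trivial
  induction hv using Submodule.iSup_induction' with
  | mem ν x hx =>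
    have hfx := S.f_pow_mem_weight i l N hx
    by_cases h : ν - (N * (l : ℕ)) • S.alpha i = μ
    · rw [h] at hfx
      rw [hp _ hfx, ← h, sub_add_cancel]
      exact Submodule.mem_map_of_mem hx
    · rw [hp' _ h _ hfx]
      exact Submodule.zero_mem _
  | zero => simp
  | add x y _ _ hx hy =>
    rw [map_add, map_add]
    exact Submodule.add_mem _ hx hy

theorem exists_coeff_of_mem_closure {ι : Type*} {α : ι → P} {y : P}
    (hy : y ∈ AddSubmonoid.closure (Set.range α)) :
    ∃ c : ι →₀ ℤ, 0 ≤ c ∧ Finsupp.linearCombination ℤ α c = y := by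
  induction hy using AddSubmonoid.closure_induction with
  | mem x hx =>
    obtain ⟨i, rfl⟩ := hx
    exact ⟨Finsupp.single i 1, by simp, by simp⟩
  | zero => exact ⟨0, le_rfl, by simp⟩
  | add x y _ _ hx hy =>
    obtain ⟨c, hc, rfl⟩ := hx
    obtain ⟨c', hc', rfl⟩ := hy
    exact ⟨c + c', add_nonneg hc hc', by simp⟩

/-- Only finitely many translates of `x` by multiples of `-α i` lie in the positive cone. -/
theorem exists_bound_sub_nsmul_mem_closure {ι : Type*} {α : ι → P} (hα : LinearIndependent ℤ α)
    (x : P) (i : ι) :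
    ∃ M : ℕ, ∀ N : ℕ, x - N • α i ∈ AddSubmonoid.closure (Set.range α) → N ≤ M := by
  by_cases h : ∃ N₀ : ℕ, x - N₀ • α i ∈ AddSubmonoid.closure (Set.range α)
  · obtain ⟨N₀, h₀⟩ := h
    obtain ⟨c₀, -, hc₀⟩ := exists_coeff_of_mem_closure h₀
    refine ⟨(c₀ i + N₀).toNat, fun N hN => ?_⟩
    obtain ⟨c, hc, hcx⟩ := exists_coeff_of_mem_closure hN
    have key : c + Finsupp.single i (N : ℤ) = c₀ + Finsupp.single i (N₀ : ℤ) := by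
      apply hα
      simp [hcx, hc₀]
    have hi := DFunLike.congr_fun key i
    simp only [Finsupp.add_apply, Finsupp.single_eq_same] at hi
    have h0 : 0 ≤ c i := hc i
    omega
  · exact ⟨0, fun N hN => (h ⟨N, hN⟩).elim⟩

theorem exists_weight_add_eq_bot (S : WeakLowerPerfectSpace k I P V) (i : I) (l : ℕ+) (μ : P) :
    ∃ M : ℕ, ∀ N, M < N → S.weight (μ + (N * (l : ℕ)) • S.alpha i) = ⊥ := by
  obtain ⟨s, hs⟩ := S.support_bounded
  choose M hM using fun x : P => exists_bound_sub_nsmul_mem_closure S.alpha_indep x i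
  refine ⟨s.sup fun lam => M (lam - μ), fun N hN => ?_⟩
  by_contra hne
  obtain ⟨lam, hlam, hmem⟩ := hs _ hne
  rw [← sub_sub] at hmem
  have h1 := hM _ _ hmem
  have h2 : M (lam - μ) ≤ _ := Finset.le_sup (f := fun lam => M (lam - μ)) hlam
  have h3 : N ≤ N * (l : ℕ) := Nat.le_mul_of_pos_right N l.pos
  omega

/-- The weight `μ` component of `f_{il}^N V` vanishes for large `N`. -/
theorem exists_proj_f_pow_eq_zero (S : WeakLowerPerfectSpace k I P V) (il : I × ℕ+) (μ : P) :
    ∃ M : ℕ, ∀ N, M < N → ∀ p : V →ₗ[k] V, (∀ v ∈ S.weight μ, p v = v) →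
      (∀ ν, ν ≠ μ → ∀ v ∈ S.weight ν, p v = 0) →
      ∀ v ∈ LinearMap.range (S.f il ^ N), p v = 0 := by
  obtain ⟨i, l⟩ := il
  obtain ⟨M, hM⟩ := S.exists_weight_add_eq_bot i l μ
  refine ⟨M, ?_⟩
  rintro N hN p hp hp' _ ⟨v, rfl⟩
  have h := S.proj_f_pow_mem i l N μ p hp hp' v
  rwa [hM N hN, Submodule.map_bot, Submodule.mem_bot] at h

theorem bddAbove_mem_range_f_pow (S : WeakLowerPerfectSpace k I P V) (il : I × ℕ+) {μ : P} {v : V}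
    (hv : v ∈ S.weight μ) (hv0 : v ≠ 0) :
    BddAbove {n : ℕ | v ∈ LinearMap.range (S.f il ^ n)} := by
  obtain ⟨p, hp, hp'⟩ := S.exists_weight_proj μ
  obtain ⟨M, hM⟩ := S.exists_proj_f_pow_eq_zero il μ
  refine ⟨M, fun N hN => ?_⟩
  by_contra! h
  exact hv0 (hp v hv ▸ hM N h p hp hp' v hN)

theorem mem_range_f_pow_d (S : WeakLowerPerfectSpace k I P V) (il : I × ℕ+) {μ : P} {v : V}
    (hv : v ∈ S.weight μ) (hv0 : v ≠ 0) :
    v ∈ LinearMap.range (S.f il ^ S.d il v) :=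
  Nat.sSup_mem (s := {n : ℕ | v ∈ LinearMap.range (S.f il ^ n)}) ⟨0, v, by simp⟩
    (S.bddAbove_mem_range_f_pow il hv hv0)

theorem range_f_pow_anti (S : WeakLowerPerfectSpace k I P V) (il : I × ℕ+) :
    Antitone fun n => LinearMap.range (S.f il ^ n) := by
  intro m n hmn
  obtain ⟨r, rfl⟩ := Nat.exists_eq_add_of_le hmn
  rintro _ ⟨v, rfl⟩
  exact ⟨(S.f il ^ r) v, by rw [pow_add, Module.End.mul_apply]⟩

theorem le_d_of_mem_range (S : WeakLowerPerfectSpace k I P V) (il : I × ℕ+) {μ : P} {v : V}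
    (hv : v ∈ S.weight μ) (hv0 : v ≠ 0) {n : ℕ} (hn : v ∈ LinearMap.range (S.f il ^ n)) :
    n ≤ S.d il v :=
  le_csSup (S.bddAbove_mem_range_f_pow il hv hv0) hn

end WeakLowerPerfectSpace

namespace LowerPerfectBasis

variable {k I P V : Type*} [Field k] [AddCommGroup P] [AddCommGroup V] [Module k V]
  {S : WeakLowerPerfectSpace k I P V} {B : Set V}

theorem ne_zero (LB : LowerPerfectBasis S B) {b : V} (hb : b ∈ B) : b ≠ 0 :=
  LB.indep.ne_zero (⟨b, hb⟩ : B)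

theorem F_iterate_mem (LB : LowerPerfectBasis S B) (il : I × ℕ+) (n : ℕ) {b : V}
    (hb : b ∈ B ∪ {0}) : (LB.F il)^[n] b ∈ B ∪ {0} := by
  induction n with
  | zero => exact hb
  | succ n ih =>
    rw [Function.iterate_succ_apply']
    rcases ih with h | h
    · exact LB.F_mem il _ h
    · rw [Set.mem_singleton_iff.mp h, LB.F_zero]
      exact Or.inr rfl

theorem F_mem_range (LB : LowerPerfectBasis S B) (il : I × ℕ+) {b : V} (hb : b ∈ B) :
    LB.F il b ∈ LinearMap.range (S.f il ^ (S.d il b + 1)) := by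
  obtain ⟨μ, hμ⟩ := LB.graded b hb
  obtain ⟨c, hc⟩ := LB.F_approx il b hb
  have h1 := S.range_f_pow_anti il (Nat.le_succ (S.d il b + 1)) hc
  have h2 : S.f il b ∈ LinearMap.range (S.f il ^ (S.d il b + 1)) := by
    obtain ⟨v, hv⟩ := S.mem_range_f_pow_d il hμ (LB.ne_zero hb)
    exact ⟨v, by rw [pow_succ', Module.End.mul_apply, hv]⟩
  have h3 := Submodule.sub_mem _ h2 h1
  rw [sub_sub_cancel] at h3
  exact (Submodule.smul_mem_iff _ c.ne_zero).mp h3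

theorem F_iterate_mem_range (LB : LowerPerfectBasis S B) (il : I × ℕ+) (n : ℕ) {b : V}
    (hb : b ∈ B) : (LB.F il)^[n] b ∈ LinearMap.range (S.f il ^ n) := by
  induction n with
  | zero => simp
  | succ n ih =>
    rw [Function.iterate_succ_apply']
    rcases LB.F_iterate_mem il n (Or.inl hb) with h | h
    · obtain ⟨μ, hμ⟩ := LB.graded _ h
      exact S.range_f_pow_anti il
        (Nat.succ_le_succ (S.le_d_of_mem_range il hμ (LB.ne_zero h) ih)) (LB.F_mem_range il h)
    · rw [Set.mem_singleton_iff.mp h, LB.F_zero]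
      exact Submodule.zero_mem _

theorem range_f_pow_le_sup_succ (LB : LowerPerfectBasis S B) (il : I × ℕ+) (n : ℕ) :
    LinearMap.range (S.f il ^ n) ≤
      Submodule.span k ((LB.F il)^[n] '' B) ⊔ LinearMap.range (S.f il ^ (n + 1)) := by
  induction n with
  | zero => simp [LB.spans]
  | succ n ih =>
    rw [pow_succ', Module.End.mul_eq_comp, LinearMap.range_comp]
    refine (Submodule.map_mono ih).trans ?_
    rw [Submodule.map_sup, Submodule.map_span, ← LinearMap.range_comp, ← Module.End.mul_eq_comp,
      ← pow_succ']
    refine sup_le (Submodule.span_le.mpr ?_) le_sup_right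
    rintro _ ⟨_, ⟨b, hb, rfl⟩, rfl⟩
    rcases LB.F_iterate_mem il n (Or.inl hb) with h | h
    · obtain ⟨μ, hμ⟩ := LB.graded _ h
      obtain ⟨c, hc⟩ := LB.F_approx il _ h
      have hn := S.le_d_of_mem_range il hμ (LB.ne_zero h) (LB.F_iterate_mem_range il n hb)
      refine Submodule.mem_sup.mpr ⟨(c : k) • LB.F il ((LB.F il)^[n] b), ?_, _,
        S.range_f_pow_anti il (Nat.add_le_add_right hn 2) hc, add_sub_cancel _ _⟩
      exact Submodule.smul_mem _ _
        (Submodule.subset_span ⟨b, hb, Function.iterate_succ_apply' _ _ _⟩)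
    · rw [Set.mem_singleton_iff.mp h, map_zero]
      exact Submodule.zero_mem _

theorem span_F_iterate_anti (LB : LowerPerfectBasis S B) (il : I × ℕ+) :
    Antitone fun n => Submodule.span k ((LB.F il)^[n] '' B) := by
  refine antitone_nat_of_succ_le fun n => Submodule.span_le.mpr ?_
  rintro _ ⟨b, hb, rfl⟩
  rw [Function.iterate_succ_apply]
  rcases LB.F_mem il b hb with h | h
  · exact Submodule.subset_span ⟨_, h, rfl⟩
  · rw [Set.mem_singleton_iff.mp h, Function.iterate_fixed (LB.F_zero il)]
    exact Submodule.zero_mem _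

theorem range_f_pow_le_sup_add (LB : LowerPerfectBasis S B) (il : I × ℕ+) (n r : ℕ) :
    LinearMap.range (S.f il ^ n) ≤
      Submodule.span k ((LB.F il)^[n] '' B) ⊔ LinearMap.range (S.f il ^ (n + r)) := by
  induction r with
  | zero => exact le_sup_right
  | succ r ih =>
    refine ih.trans (sup_le le_sup_left ((LB.range_f_pow_le_sup_succ il (n + r)).trans ?_))
    exact sup_le_sup_right (LB.span_F_iterate_anti il (Nat.le_add_right n r)) _

theorem proj_mem_span_F_iterate (LB : LowerPerfectBasis S B) (il : I × ℕ+) (n : ℕ) (μ : P)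
    (p : V →ₗ[k] V) (hp : ∀ v ∈ S.weight μ, p v = v)
    (hp' : ∀ ν, ν ≠ μ → ∀ v ∈ S.weight ν, p v = 0) {v : V}
    (hv : v ∈ Submodule.span k ((LB.F il)^[n] '' B)) :
    p v ∈ Submodule.span k ((LB.F il)^[n] '' B) := by
  suffices h : Submodule.span k ((LB.F il)^[n] '' B) ≤
      (Submodule.span k ((LB.F il)^[n] '' B)).comap p from h hv
  refine Submodule.span_le.mpr fun x hx => ?_
  rw [SetLike.mem_coe, Submodule.mem_comap]
  have hxB : x ∈ B ∪ {0} := by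
    obtain ⟨b, hb, rfl⟩ := hx
    exact LB.F_iterate_mem il n (Or.inl hb)
  rcases hxB with h | h
  · obtain ⟨ν, hν⟩ := LB.graded x h
    by_cases hνμ : ν = μ
    · rw [hp x (hνμ ▸ hν)]
      exact Submodule.subset_span hx
    · rw [hp' ν hνμ x hν]
      exact Submodule.zero_mem _
  · rw [Set.mem_singleton_iff.mp h, map_zero]
    exact Submodule.zero_mem _

theorem range_f_pow_le_span (LB : LowerPerfectBasis S B) (il : I × ℕ+) (n : ℕ) :
    LinearMap.range (S.f il ^ n) ≤ Submodule.span k ((LB.F il)^[n] '' B) := by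
  rw [LinearMap.range_eq_map, ← S.weight_sup, Submodule.map_iSup]
  refine iSup_le fun ν => ?_
  rintro _ ⟨v, hv, rfl⟩
  have hw := S.f_pow_mem_weight il.1 il.2 n hv
  obtain ⟨p, hp, hp'⟩ := S.exists_weight_proj (ν - (n * (il.2 : ℕ)) • S.alpha il.1)
  obtain ⟨M, hM⟩ := S.exists_proj_f_pow_eq_zero il (ν - (n * (il.2 : ℕ)) • S.alpha il.1)
  obtain ⟨s, hs, t, ht, hst⟩ := Submodule.mem_sup.mp
    (LB.range_f_pow_le_sup_add il n (M + 1) (LinearMap.mem_range_self _ v))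
  have key : (S.f il ^ n) v = p s := by
    rw [← hp _ hw, ← hst, map_add, hM _ (by omega) p hp hp' t ht, add_zero]
  rw [key]
  exact LB.proj_mem_span_F_iterate il n _ p hp hp' hs

end LowerPerfectBasis

theorem stmt_1 {k I P V : Type*} [Field k] [AddCommGroup P] [AddCommGroup V] [Module k V]
    (S : WeakLowerPerfectSpace k I P V) (B : Set V) (LB : LowerPerfectBasis S B)
    (il : I × ℕ+) (n : ℕ) :
    ((LB.F il)^[n] '' B) \ {0} ⊆ B ∧
    LinearMap.range (S.f il ^ n) = Submodule.span k (((LB.F il)^[n] '' B) \ {0}) := by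
  rw [Submodule.span_sdiff_singleton_zero]
  refine ⟨?_, le_antisymm (LB.range_f_pow_le_span il n) (Submodule.span_le.mpr ?_)⟩
  · rintro _ ⟨⟨b, hb, rfl⟩, h0⟩
    exact (LB.F_iterate_mem il n (Or.inl hb)).resolve_right h0
  · rintro _ ⟨b, hb, rfl⟩
    exact LB.F_iterate_mem_range il n hb
end

section
/- Let (V, {f_{il}}) be a weak lower perfect space over k with a lower perfect basis B, let i = ((i_k,l_k))_{k≥1} be a good index sequence, and let a be a good sequence of non-negative integers with a_k = 0 for all k ≥ r+1. Then the map 𝐞_{i,a} : B_{i,a} → B_H, b ↦ 𝐞_{i_rl_r}^{a_r}⋯𝐞_{i_1l_1}^{a_1}(b), is well-defined (its values lie in B_H) and injective. -/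
open Function

/-- Iterated application `𝐟_{i_1 l_1}^{a_1} ⋯ 𝐟_{i_r l_r}^{a_r}(b)` (rightmost factor applied
first): `fComp F seq a r b = F_{seq 0}^{a 0} (⋯ (F_{seq (r-1)}^{a (r-1)} b))`. -/
def fComp {V ι : Type*} (F : ι → V → V) (seq : ℕ → ι) (a : ℕ → ℕ) : ℕ → V → V
  | 0, v => v
  | m + 1, v => fComp F seq a m ((F (seq m))^[a m] v)

/-- Iterated application `𝐞_{i_r l_r}^{a_r} ⋯ 𝐞_{i_1 l_1}^{a_1}(b)` (leftmost index applied
first): `eComp E seq a r b = E_{seq (r-1)}^{a (r-1)} (⋯ (E_{seq 0}^{a 0} b))`. -/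
def eComp {V ι : Type*} (E : ι → V → V) (seq : ℕ → ι) (a : ℕ → ℕ) : ℕ → V → V
  | 0, v => v
  | m + 1, v => (E (seq m))^[a m] (eComp E seq a m v)

/-- The sequence `b_0 = b`, `b_{k+1} = 𝐞_{i_{k+1} l_{k+1}}^{d_{i_{k+1} l_{k+1}}(b_k)}(b_k)`. -/
def bseq {V ι : Type*} (E : ι → V → V) (d : ι → V → ℕ) (seq : ℕ → ι) (b : V) : ℕ → V
  | 0 => b
  | m + 1 => (E (seq m))^[d (seq m) (bseq E d seq b m)] (bseq E d seq b m)

/-- The lexicographic strict order on sequences of non-negative integers. -/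
def SeqLt (a a' : ℕ → ℕ) : Prop :=
  ∃ m : ℕ, (∀ s < m, a s = a' s) ∧ a m < a' m

/-- The lexicographic order on sequences of non-negative integers. -/
def SeqLe (a a' : ℕ → ℕ) : Prop := a = a' ∨ SeqLt a a'

namespace WeakLowerPerfectSpace

variable {k I P V : Type*} [Field k] [AddCommGroup P] [AddCommGroup V] [Module k V]

/-- The composite `f_{i_1 l_1}^{a_1} ⋯ f_{i_m l_m}^{a_m}` (as an endomorphism, the
rightmost factor acting first). -/
noncomputable def pprod (S : WeakLowerPerfectSpace k I P V) (seq : ℕ → I × ℕ+)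
    (a : ℕ → ℕ) (m : ℕ) : Module.End k V :=
  ((List.range m).map fun j => S.f (seq j) ^ a j).prod

/-- The subspace `V^{>i,a} = Σ_{k=1}^r f_{i_1l_1}^{a_1}⋯f_{i_{k−1}l_{k−1}}^{a_{k−1}} f_{i_kl_k}^{a_k+1} V`. -/
noncomputable def Vgt (S : WeakLowerPerfectSpace k I P V) (seq : ℕ → I × ℕ+)
    (a : ℕ → ℕ) (r : ℕ) : Submodule k V :=
  ⨆ m : Fin r, LinearMap.range (S.pprod seq a (m : ℕ) * S.f (seq (m : ℕ)) ^ (a (m : ℕ) + 1))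

/-- The subspace `V^{≥i,a} = V^{>i,a} + f_{i_1l_1}^{a_1}⋯f_{i_rl_r}^{a_r} V`. -/
noncomputable def Vge (S : WeakLowerPerfectSpace k I P V) (seq : ℕ → I × ℕ+)
    (a : ℕ → ℕ) (r : ℕ) : Submodule k V :=
  S.Vgt seq a r ⊔ LinearMap.range (S.pprod seq a r)

end WeakLowerPerfectSpace

namespace WeakLowerPerfectSpace

variable {k I P V : Type*} [Field k] [AddCommGroup P] [AddCommGroup V] [Module k V]

/-- Going up from a fixed weight in a simple-root direction, one eventually leaves the support. -/
theorem eventually_weight_eq_bot (S : WeakLowerPerfectSpace k I P V) (i : I) (l : ℕ+) (μ : P) :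
    ∃ N : ℕ, S.weight (μ + (N * (l : ℕ)) • S.alpha i) = ⊥ := by
  obtain ⟨s, hs⟩ := S.support_bounded
  have hnat : LinearIndependent ℕ S.alpha :=
    S.alpha_indep.restrict_scalars (fun m n h => by simpa using h)
  have key : ∀ lam ∈ s, ∀ᶠ N : ℕ in Filter.atTop,
      lam - (μ + (N * (l : ℕ)) • S.alpha i) ∉ AddSubmonoid.closure (Set.range S.alpha) := by
    intro lam _
    by_cases h : ∃ N₀ : ℕ,
        lam - (μ + (N₀ * (l : ℕ)) • S.alpha i) ∈ AddSubmonoid.closure (Set.range S.alpha)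
    · obtain ⟨N₀, h₀⟩ := h
      rw [← Submodule.span_nat_eq_addSubmonoidClosure, Submodule.mem_toAddSubmonoid,
        Finsupp.mem_span_range_iff_exists_finsupp] at h₀
      obtain ⟨c, hc⟩ := h₀
      filter_upwards [Filter.eventually_ge_atTop (N₀ + (c i + 1))] with N hN h₁
      obtain ⟨t, rfl⟩ := Nat.exists_eq_add_of_le hN
      rw [← Submodule.span_nat_eq_addSubmonoidClosure, Submodule.mem_toAddSubmonoid,
        Finsupp.mem_span_range_iff_exists_finsupp] at h₁
      obtain ⟨c', hc'⟩ := h₁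
      have heq : Finsupp.linearCombination ℕ S.alpha c = Finsupp.linearCombination ℕ S.alpha
          (c' + Finsupp.single i ((c i + 1 + t) * (l : ℕ))) := by
        rw [map_add, Finsupp.linearCombination_single, Finsupp.linearCombination_apply,
          Finsupp.linearCombination_apply, hc, hc', add_assoc N₀, add_mul N₀, add_smul]
        abel
      have hi := DFunLike.congr_fun (hnat heq) i
      simp only [Finsupp.coe_add, Pi.add_apply, Finsupp.single_eq_same] at hi
      have := Nat.le_mul_of_pos_right (c i + 1 + t) l.pos
      omega
    · push Not at h
      exact Filter.Eventually.of_forall h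
  obtain ⟨N, hN⟩ := ((Filter.eventually_all_finset s).2 key).exists
  refine ⟨N, ?_⟩
  by_contra hne
  obtain ⟨lam, hlam, hmem⟩ := hs _ hne
  exact hN lam hlam hmem

theorem pow_f_mem_weight (S : WeakLowerPerfectSpace k I P V) (i : I) (l : ℕ+) (N : ℕ) {μ : P}
    {v : V} (hv : v ∈ S.weight μ) :
    (S.f (i, l) ^ N) v ∈ S.weight (μ - (N * (l : ℕ)) • S.alpha i) := by
  induction N with
  | zero => simpa using hv
  | succ N ih =>
    rw [pow_succ', Module.End.mul_apply, add_mul, one_mul, add_smul, ← sub_sub]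
    exact S.f_weight i l _ (Submodule.mem_map_of_mem ih)

theorem range_pow_anti (f : Module.End k V) :
    Antitone fun n : ℕ => LinearMap.range (f ^ n) := by
  intro m n h
  obtain ⟨t, rfl⟩ := Nat.exists_eq_add_of_le h
  rintro _ ⟨v, rfl⟩
  exact ⟨(f ^ t) v, by rw [pow_add, Module.End.mul_apply]⟩

theorem map_range_pow (f : Module.End k V) (n : ℕ) :
    (LinearMap.range (f ^ n)).map f = LinearMap.range (f ^ (n + 1)) := by
  rw [pow_succ', Module.End.mul_eq_comp, LinearMap.range_comp]

end WeakLowerPerfectSpace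

namespace LowerPerfectBasis

variable {k I P V : Type*} [Field k] [AddCommGroup P] [AddCommGroup V] [Module k V]
  {S : WeakLowerPerfectSpace k I P V} {B : Set V}

/-- The underlying basis of a lower perfect basis. -/
noncomputable def basis (LB : LowerPerfectBasis S B) : Module.Basis B k V :=
  Module.Basis.mk LB.indep (by rw [Subtype.range_coe, LB.spans])

@[simp]
theorem basis_apply (LB : LowerPerfectBasis S B) (b : B) : LB.basis b = b := by
  simp [basis]

theorem repr_self (LB : LowerPerfectBasis S B) (b : B) : LB.basis.repr (b : V) b = 1 := by
  have h := congrArg (fun c => c b) (LB.basis.repr_self b)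
  simpa using h

theorem mem_span_iff_repr (LB : LowerPerfectBasis S B) (p : V → Prop) (v : V) :
    v ∈ Submodule.span k {b | b ∈ B ∧ p b} ↔ ∀ b : B, LB.basis.repr v b ≠ 0 → p b := by
  have himage : {b | b ∈ B ∧ p b} = LB.basis '' {b : B | p b} := by
    ext x
    simp [and_comm]
  rw [himage, Module.Basis.mem_span_image]
  simp [Set.subset_def]

theorem mem_span_iff (LB : LowerPerfectBasis S B) (p : V → Prop) {b : V} (hb : b ∈ B) :
    b ∈ Submodule.span k {b | b ∈ B ∧ p b} ↔ p b := by
  refine ⟨fun h => ?_, fun h => Submodule.subset_span ⟨hb, h⟩⟩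
  rw [LB.mem_span_iff_repr] at h
  exact h ⟨b, hb⟩ ((LB.repr_self ⟨b, hb⟩).trans_ne one_ne_zero)

theorem weight_le_span (LB : LowerPerfectBasis S B) (ν : P) :
    S.weight ν ≤ Submodule.span k {b | b ∈ B ∧ b ∈ S.weight ν} := by
  intro x hx
  have hsplit : x ∈ Submodule.span k {b | b ∈ B ∧ b ∈ S.weight ν} ⊔
      Submodule.span k {b | b ∈ B ∧ b ∉ S.weight ν} := by
    rw [← Submodule.span_union]
    have hB : {b | b ∈ B ∧ b ∈ S.weight ν} ∪ {b | b ∈ B ∧ b ∉ S.weight ν} = B := by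
      ext b
      simp only [Set.mem_union, Set.mem_ofPred_eq]
      tauto
    rw [hB, LB.spans]
    trivial
  obtain ⟨p, hp, q, hq, rfl⟩ := Submodule.mem_sup.1 hsplit
  have hpν : p ∈ S.weight ν :=
    (Submodule.span_le.2 fun b hb => hb.2 :
      Submodule.span k {b | b ∈ B ∧ b ∈ S.weight ν} ≤ S.weight ν) hp
  have hqν : q ∈ S.weight ν := by
    simpa using Submodule.sub_mem _ hx hpν
  have hq' : q ∈ ⨆ μ : P, ⨆ _ : μ ≠ ν, S.weight μ := by
    refine (Submodule.span_le.2 ?_ :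
      Submodule.span k {b | b ∈ B ∧ b ∉ S.weight ν} ≤ _) hq
    rintro b ⟨hb, hbν⟩
    obtain ⟨μ, hμ⟩ := LB.graded b hb
    have hne : μ ≠ ν := by
      rintro rfl
      exact hbν hμ
    exact Submodule.mem_iSup_of_mem μ (Submodule.mem_iSup_of_mem hne hμ)
  have hq0 : q = 0 := Submodule.disjoint_def.1 (S.weight_indep ν) q hqν hq'
  rw [hq0, add_zero]
  exact hp

theorem repr_eq_zero_of_weight_ne (LB : LowerPerfectBasis S B) {μ ν : P} (hne : μ ≠ ν) {b : B}
    (hb : (b : V) ∈ S.weight μ) {x : V} (hx : x ∈ S.weight ν) : LB.basis.repr x b = 0 := by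
  by_contra h
  have hbν : (b : V) ∈ S.weight ν := (LB.mem_span_iff_repr _ x).1 (LB.weight_le_span ν hx) b h
  exact LB.ne_zero b.2
    (Submodule.disjoint_def.1 (S.weight_indep.pairwiseDisjoint hne) _ hb hbν)

/-- Each coordinate functional vanishes on a sufficiently high power of `f_{il}`. -/
theorem exists_repr_pow_f_eq_zero (LB : LowerPerfectBasis S B) (il : I × ℕ+) (b : B) :
    ∃ N : ℕ, ∀ v ∈ LinearMap.range (S.f il ^ N), LB.basis.repr v b = 0 := by
  obtain ⟨i, l⟩ := il
  obtain ⟨μ, hμ⟩ := LB.graded b b.2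
  obtain ⟨N, hN⟩ := S.eventually_weight_eq_bot i l μ
  refine ⟨N, ?_⟩
  rintro _ ⟨u, rfl⟩
  have hzero : LB.basis.coord b ∘ₗ (S.f (i, l) ^ N) = 0 := by
    refine LB.basis.ext fun b' => ?_
    obtain ⟨ν, hν⟩ := LB.graded b' b'.2
    have hmem := S.pow_f_mem_weight i l N hν
    simp only [LinearMap.comp_apply, basis_apply, Module.Basis.coord_apply, LinearMap.zero_apply]
    refine LB.repr_eq_zero_of_weight_ne (fun h => LB.ne_zero b'.2 ?_) hμ hmem
    rw [h, sub_add_cancel] at hN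
    rw [hN] at hν
    exact (Submodule.mem_bot k).1 hν
  exact LinearMap.congr_fun hzero u

theorem mem_range_pow_iff (LB : LowerPerfectBasis S B) (il : I × ℕ+) {b : V} (hb : b ∈ B)
    (n : ℕ) : b ∈ LinearMap.range (S.f il ^ n) ↔ n ≤ S.d il b := by
  obtain ⟨N, hN⟩ := LB.exists_repr_pow_f_eq_zero il ⟨b, hb⟩
  have hbdd : BddAbove {n : ℕ | b ∈ LinearMap.range (S.f il ^ n)} := by
    refine ⟨N, fun n hn => ?_⟩
    by_contra hlt
    have h0 := hN b (WeakLowerPerfectSpace.range_pow_anti _ (not_le.1 hlt).le hn)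
    exact one_ne_zero ((LB.repr_self ⟨b, hb⟩).symm.trans h0)
  refine ⟨fun h => le_csSup hbdd h, fun h => WeakLowerPerfectSpace.range_pow_anti _ h ?_⟩
  exact Nat.sSup_mem ⟨0, by simp⟩ hbdd

theorem F_eq_zero_or_lt_d (LB : LowerPerfectBasis S B) (il : I × ℕ+) {b : V} (hb : b ∈ B) :
    LB.F il b = 0 ∨ LB.F il b ∈ B ∧ S.d il b + 1 ≤ S.d il (LB.F il b) := by
  rcases LB.F_mem il b hb with h | h
  · refine Or.inr ⟨h, (LB.mem_range_pow_iff il h _).1 ?_⟩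
    obtain ⟨c, hc⟩ := LB.F_approx il b hb
    have hfb : S.f il b ∈ LinearMap.range (S.f il ^ (S.d il b + 1)) := by
      rw [← WeakLowerPerfectSpace.map_range_pow]
      exact Submodule.mem_map_of_mem ((LB.mem_range_pow_iff il hb _).2 le_rfl)
    have hcF := Submodule.sub_mem _ hfb
      (WeakLowerPerfectSpace.range_pow_anti (S.f il) (Nat.le_succ (S.d il b + 1)) hc)
    rw [sub_sub_cancel] at hcF
    exact (Submodule.smul_mem_iff _ c.ne_zero).1 hcF
  · exact Or.inl h

theorem range_pow_le_sup (LB : LowerPerfectBasis S B) (il : I × ℕ+) (n : ℕ) :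
    LinearMap.range (S.f il ^ n) ≤
      Submodule.span k {b | b ∈ B ∧ n ≤ S.d il b} ⊔ LinearMap.range (S.f il ^ (n + 1)) := by
  induction n with
  | zero => simp [LB.spans]
  | succ n ih =>
    rw [← WeakLowerPerfectSpace.map_range_pow]
    refine (Submodule.map_mono ih).trans ?_
    rw [Submodule.map_sup, WeakLowerPerfectSpace.map_range_pow]
    refine sup_le ?_ le_sup_right
    rw [Submodule.map_span, Submodule.span_le]
    rintro _ ⟨b, ⟨hb, hn⟩, rfl⟩
    obtain ⟨c, hc⟩ := LB.F_approx il b hb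
    rw [SetLike.mem_coe, ← add_sub_cancel ((c : k) • LB.F il b) (S.f il b)]
    refine Submodule.add_mem_sup (Submodule.smul_mem _ _ ?_)
      (WeakLowerPerfectSpace.range_pow_anti _ (by omega) hc)
    rcases LB.F_eq_zero_or_lt_d il hb with h | ⟨h, hd⟩
    · rw [h]
      exact Submodule.zero_mem _
    · exact Submodule.subset_span ⟨h, by omega⟩

/-- The image of `f_{il}^n` is spanned by the basis elements it contains. -/
theorem range_pow_eq_span (LB : LowerPerfectBasis S B) (il : I × ℕ+) (n : ℕ) :
    LinearMap.range (S.f il ^ n) = Submodule.span k {b | b ∈ B ∧ n ≤ S.d il b} := by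
  refine le_antisymm ?_ (Submodule.span_le.2 fun b hb => (LB.mem_range_pow_iff il hb.1 n).2 hb.2)
  have hiter : ∀ j : ℕ, LinearMap.range (S.f il ^ n) ≤
      Submodule.span k {b | b ∈ B ∧ n ≤ S.d il b} ⊔ LinearMap.range (S.f il ^ (n + j)) := by
    intro j
    induction j with
    | zero => exact le_sup_right
    | succ j ih =>
      refine ih.trans (sup_le le_sup_left ((LB.range_pow_le_sup il (n + j)).trans
        (sup_le_sup_right (Submodule.span_mono ?_) _)))
      exact fun b hb => ⟨hb.1, (Nat.le_add_right n j).trans hb.2⟩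
  intro v hv
  rw [LB.mem_span_iff_repr]
  intro b hb
  obtain ⟨N, hN⟩ := LB.exists_repr_pow_f_eq_zero il b
  obtain ⟨w, hw, u, hu, rfl⟩ := Submodule.mem_sup.1 (hiter N hv)
  have hu0 := hN u (WeakLowerPerfectSpace.range_pow_anti _ (Nat.le_add_left N n) hu)
  rw [map_add, Finsupp.add_apply, hu0, add_zero] at hb
  exact (LB.mem_span_iff_repr _ w).1 hw b hb

/-- Every basis element of depth `n + 1` is the image under `𝐟_{il}` of one of depth `n`. -/
theorem exists_F_eq (LB : LowerPerfectBasis S B) (il : I × ℕ+) {b : V} (hb : b ∈ B) {n : ℕ}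
    (hd : S.d il b = n + 1) : ∃ b' ∈ B, S.d il b' = n ∧ LB.F il b' = b := by
  have hle : LinearMap.range (S.f il ^ (n + 1)) ≤ Submodule.span k
      {c | c ∈ B ∧ ((∃ b' ∈ B, S.d il b' = n ∧ LB.F il b' = c) ∨ n + 2 ≤ S.d il c)} := by
    have hle' : LinearMap.range (S.f il ^ (n + 2)) ≤ Submodule.span k
        {c | c ∈ B ∧ ((∃ b' ∈ B, S.d il b' = n ∧ LB.F il b' = c) ∨ n + 2 ≤ S.d il c)} := by
      rw [LB.range_pow_eq_span]
      exact Submodule.span_mono fun c hc => ⟨hc.1, Or.inr hc.2⟩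
    rw [← WeakLowerPerfectSpace.map_range_pow, LB.range_pow_eq_span, Submodule.map_span,
      Submodule.span_le]
    rintro _ ⟨b', ⟨hb', hn⟩, rfl⟩
    rcases hn.eq_or_lt with hn | hn
    · obtain ⟨c, hc⟩ := LB.F_approx il b' hb'
      rw [SetLike.mem_coe, ← add_sub_cancel ((c : k) • LB.F il b') (S.f il b')]
      rw [← hn] at hc
      refine Submodule.add_mem _ (Submodule.smul_mem _ _ ?_) (hle' hc)
      rcases LB.F_mem il b' hb' with h | h
      · exact Submodule.subset_span ⟨h, Or.inl ⟨b', hb', hn.symm, rfl⟩⟩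
      · rw [Set.mem_singleton_iff.1 h]
        exact Submodule.zero_mem _
    · refine hle' ?_
      rw [← WeakLowerPerfectSpace.map_range_pow]
      exact Submodule.mem_map_of_mem ((LB.mem_range_pow_iff il hb' _).2 hn)
  rcases (LB.mem_span_iff _ hb).1 (hle ((LB.mem_range_pow_iff il hb _).2 hd.ge)) with h | h
  · exact h
  · omega

/-- Raising a basis element `d_{il}` times stays in the basis and is undone by `𝐟_{il}`. -/
theorem iterate_E_mem (LB : LowerPerfectBasis S B) {E : I × ℕ+ → V → V}
    (hEdef : ∀ il : I × ℕ+, ∀ b ∈ B, ∀ b' ∈ B, LB.F il b' = b → E il b = b')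
    (il : I × ℕ+) (n : ℕ) {b : V} (hb : b ∈ B) (hd : S.d il b = n) :
    (E il)^[n] b ∈ B ∧ (LB.F il)^[n] ((E il)^[n] b) = b := by
  induction n generalizing b with
  | zero => exact ⟨hb, rfl⟩
  | succ n ih =>
    obtain ⟨b', hb', hd', rfl⟩ := LB.exists_F_eq il hb hd
    rw [Function.iterate_succ_apply, hEdef il _ hb b' hb' rfl, Function.iterate_succ_apply']
    obtain ⟨h₁, h₂⟩ := ih hb' hd'
    exact ⟨h₁, by rw [h₂]⟩

theorem eComp_mem (LB : LowerPerfectBasis S B) {E : I × ℕ+ → V → V}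
    (hEdef : ∀ il : I × ℕ+, ∀ b ∈ B, ∀ b' ∈ B, LB.F il b' = b → E il b = b')
    (seq : ℕ → I × ℕ+) (a : ℕ → ℕ) {b : V} (hb : b ∈ B)
    (hd : ∀ m : ℕ, S.d (seq m) (eComp E seq a m b) = a m) (m : ℕ) :
    eComp E seq a m b ∈ B ∧ fComp LB.F seq a m (eComp E seq a m b) = b := by
  induction m with
  | zero => exact ⟨hb, rfl⟩
  | succ m ih =>
    obtain ⟨h₁, h₂⟩ := LB.iterate_E_mem hEdef (seq m) (a m) ih.1 (hd m)
    refine ⟨h₁, ?_⟩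
    rw [eComp, fComp, h₂, ih.2]

end LowerPerfectBasis

theorem bseq_eq_eComp {V ι : Type*} (E : ι → V → V) (d : ι → V → ℕ) (seq : ℕ → ι) (a : ℕ → ℕ)
    (b : V) (hd : ∀ m : ℕ, d (seq m) (bseq E d seq b m) = a m) (m : ℕ) :
    bseq E d seq b m = eComp E seq a m b := by
  induction m with
  | zero => rfl
  | succ m ih => rw [bseq, hd, ih, eComp]

theorem eComp_eq_of_eq_zero {V ι : Type*} (E : ι → V → V) (seq : ℕ → ι) {a : ℕ → ℕ} {r : ℕ}
    (ha : ∀ m ≥ r, a m = 0) (b : V) {m : ℕ} (hm : r ≤ m) :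
    eComp E seq a m b = eComp E seq a r b := by
  induction m, hm using Nat.le_induction with
  | base => rfl
  | succ m hm ih => rw [eComp, ha m hm, Function.iterate_zero_apply, ih]

theorem stmt_9 {k I P V : Type*} [Field k] [AddCommGroup P] [AddCommGroup V] [Module k V]
    (S : WeakLowerPerfectSpace k I P V) (B : Set V) (LB : LowerPerfectBasis S B)
(E : I × ℕ+ → V → V)
    (hE0 : ∀ il : I × ℕ+, E il 0 = 0)
    (hEdef : ∀ il : I × ℕ+, ∀ b ∈ B, ∀ b' ∈ B, LB.F il b' = b → E il b = b')
    (hEnone : ∀ il : I × ℕ+, ∀ b ∈ B, (∀ b' ∈ B, LB.F il b' ≠ b) → E il b = 0)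
    (seq : ℕ → I × ℕ+) (hseq : ∀ p : I × ℕ+, ∀ N : ℕ, ∃ m ≥ N, seq m = p)
    (a : ℕ → ℕ) (r : ℕ) (ha : ∀ m ≥ r, a m = 0) :
    (∀ b ∈ B, (∀ m : ℕ, S.d (seq m) (bseq E S.d seq b m) = a m) →
      eComp E seq a r b ∈ S.highestCore B) ∧
    (∀ b ∈ B, ∀ b' ∈ B, (∀ m : ℕ, S.d (seq m) (bseq E S.d seq b m) = a m) →
      (∀ m : ℕ, S.d (seq m) (bseq E S.d seq b' m) = a m) →
      eComp E seq a r b = eComp E seq a r b' → b = b') := by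
  have hdepth : ∀ b : V, (∀ m : ℕ, S.d (seq m) (bseq E S.d seq b m) = a m) →
      ∀ m : ℕ, S.d (seq m) (eComp E seq a m b) = a m := fun b h m => by
    rw [← bseq_eq_eComp E S.d seq a b h m, h m]
  refine ⟨fun b hb h => ⟨(LB.eComp_mem hEdef seq a hb (hdepth b h) r).1, fun il => ?_⟩,
    fun b hb b' hb' h h' heq => ?_⟩
  · obtain ⟨m, hm, rfl⟩ := hseq il r
    rw [← eComp_eq_of_eq_zero E seq ha b hm, hdepth b h m, ha m hm]
  · rw [← (LB.eComp_mem hEdef seq a hb (hdepth b h) r).2, heq,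
      (LB.eComp_mem hEdef seq a hb' (hdepth b' h') r).2]
end
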